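/- arXiv:1901.01257 — 2 statements merged into one kernel-verified Lean document; each statement's English description precedes it below -/
import Mathlib

section
/- Let C be a pretriangulated category, and let D be a full subcategory of C which is closed under isomorphisms and under the shift functors, and whose inclusion functor ι : D → C admits a right adjoint R, with counit ε. Then for every object A of C and every distinguished triangle ι(R(A)) → A → B → (ι(R(A)))[1] whose first morphism is the counit ε_A, the object B lies in the right orthogonal of D: for every object X of D, every morphism ι(X) → B in C is zero (equivalently, R(B) ≅ 0). -/
open CategoryTheory Category Limits Pretriangulated

namespace CategoryTheory.Adjunction

/-- For a fully faithful left adjoint `ι`, morphisms in `C` between objects coming from `D`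
are determined by their composition with the counit. -/
lemma eq_of_comp_counit_eq {C D : Type*} [Category C] [Category D] {ι : D ⥤ C} [ι.Full]
    {R : C ⥤ D} (adj : ι ⊣ R) {Y : D} {A : C} {v w : ι.obj Y ⟶ ι.obj (R.obj A)}
    (hvw : v ≫ adj.counit.app A = w ≫ adj.counit.app A) : v = w := by
  obtain ⟨v, rfl⟩ := ι.map_surjective v
  obtain ⟨w, rfl⟩ := ι.map_surjective w
  congr 1
  apply (adj.homEquiv Y A).symm.injective
  simpa only [adj.homEquiv_counit] using hvw

/-- A morphism `ι.obj X ⟶ (ι.obj (R.obj A))⟦1⟧` killed by the shifted counit is zero, provided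
that `(ι.obj X)⟦-1⟧` is in the essential image of `ι`. -/
lemma eq_zero_of_comp_shift_counit_eq_zero {C D : Type*} [Category C] [Preadditive C]
    [HasShift C ℤ] [∀ n : ℤ, (shiftFunctor C n).Additive] [Category D] {ι : D ⥤ C} [ι.Full]
    {R : C ⥤ D} (adj : ι ⊣ R) {X Y : D} (e : (ι.obj X)⟦(-1 : ℤ)⟧ ≅ ι.obj Y) {A : C}
    (u : ι.obj X ⟶ (ι.obj (R.obj A))⟦(1 : ℤ)⟧) (hu : u ≫ (adj.counit.app A)⟦(1 : ℤ)⟧' = 0) :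
    u = 0 := by
  let e' : (ι.obj Y)⟦(1 : ℤ)⟧ ≅ ι.obj X :=
    (shiftFunctor C (1 : ℤ)).mapIso e.symm ≪≫
      (shiftFunctorCompIsoId C (-1 : ℤ) 1 (by simp)).app (ι.obj X)
  obtain ⟨v, hv⟩ := (shiftFunctor C (1 : ℤ)).map_surjective (e'.hom ≫ u)
  have hv₀ : v = 0 := by
    apply adj.eq_of_comp_counit_eq
    apply (shiftFunctor C (1 : ℤ)).map_injective
    rw [Functor.map_comp, hv, Category.assoc, hu, comp_zero, zero_comp, Functor.map_zero]
  rw [← cancel_epi e'.hom, ← hv, hv₀, Functor.map_zero, comp_zero]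

end CategoryTheory.Adjunction

/-- Let `C` be a pretriangulated category and let `D` be a full subcategory (realized as a
fully faithful functor `ι : D ⥤ C`) which is closed under isomorphisms and under the shift
functors of `C`, and such that `ι` admits a right adjoint `R`.  Then for every object `A`
of `C` and every distinguished triangle
`ι(R(A)) ⟶ A ⟶ B ⟶ (ι(R(A)))⟦1⟧` whose first morphism is the counit of the adjunction,
the third object `B` lies in the right orthogonal of `D`: every morphism `ι(X) ⟶ B`
with `X` in `D` is zero. -/
theorem cone_of_counit_mem_rightOrthogonal
    {C : Type*} [Category C] [HasZeroObject C] [Preadditive C] [HasShift C ℤ]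
    [∀ n : ℤ, (shiftFunctor C n).Additive] [Pretriangulated C]
    {D : Type*} [Category D] (ι : D ⥤ C) [ι.Full] [ι.Faithful]
    (R : C ⥤ D) (adj : ι ⊣ R)
    (hiso : ∀ (X : D) (A : C), Nonempty (ι.obj X ≅ A) → ∃ Y : D, Nonempty (ι.obj Y ≅ A))
    (hshift : ∀ (X : D) (k : ℤ), ∃ Y : D, Nonempty ((ι.obj X)⟦k⟧ ≅ ι.obj Y))
    (A B : C) (g : A ⟶ B) (h : B ⟶ (ι.obj (R.obj A))⟦(1 : ℤ)⟧)
    (hT : Triangle.mk (adj.counit.app A) g h ∈ distTriang C) :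
    ∀ (X : D) (f : ι.obj X ⟶ B), f = 0 := by
  intro X f
  obtain ⟨Y, ⟨e⟩⟩ := hshift X (-1)
  have hh : h ≫ (adj.counit.app A)⟦(1 : ℤ)⟧' = 0 := comp_distTriang_mor_zero₃₁ _ hT
  have hfh : f ≫ h = 0 :=
    adj.eq_zero_of_comp_shift_counit_eq_zero e (f ≫ h) (by rw [assoc, hh, comp_zero])
  obtain ⟨a, rfl⟩ : ∃ a : ι.obj X ⟶ A, f = a ≫ g := Triangle.coyoneda_exact₃ _ hT f hfh
  have hg : adj.counit.app A ≫ g = 0 := comp_distTriang_mor_zero₁₂ _ hT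
  obtain ⟨b, rfl⟩ := (adj.homEquiv X A).symm.surjective a
  rw [adj.homEquiv_counit, assoc, hg, comp_zero]
end

section
/- Let C be a pretriangulated category and let D_0, D_1, …, D_m be full subcategories of C, each closed under isomorphisms and under the shift functors, such that the inclusion functor ι_k : D_k → C admits a right adjoint R_k for each k, and such that the semi-orthogonality condition holds: for all 0 ≤ i < j ≤ m, every morphism in C from an object of D_j to an object of D_i is zero. Then for every object A of C there exist objects A_0 = A, A_1, …, A_{m+1} of C and, for each k = 0, …, m, a distinguished triangle ι_{m−k}(R_{m−k}(A_k)) → A_k → A_{k+1} → (ι_{m−k}(R_{m−k}(A_k)))[1] whose first morphism is the counit, such that the final object A_{m+1} satisfies: for every i ∈ {0, …, m} and every object X of D_i, every morphism ι_i(X) → A_{m+1} is zero (equivalently, R_i(A_{m+1}) ≅ 0 for all i). -/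
open CategoryTheory Category Limits Pretriangulated

/-- Dependent choice along `Fin (n + 1)`: a family of total relations admits a chain starting
at any given point. -/
theorem exists_fin_chain {α : Type*} {n : ℕ} (P : Fin n → α → α → Prop)
    (hP : ∀ k a, ∃ b, P k a b) (a : α) :
    ∃ s : Fin (n + 1) → α, s 0 = a ∧ ∀ k : Fin n, P k (s k.castSucc) (s k.succ) := by
  choose next hnext using hP
  refine ⟨fun k => Fin.induction (motive := fun _ => α) a next k, rfl, fun k => ?_⟩
  simp only [Fin.induction_succ]
  exact hnext _ _

/-- Composition with the counit of `F ⊣ G` is injective on morphisms from `F.obj X`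
when `F` is full. -/
theorem eq_zero_of_comp_counit_eq_zero {C : Type*} [Category C] [Preadditive C]
    {D : Type*} [Category D] {F : D ⥤ C} {G : C ⥤ D} [F.Full] (adj : F ⊣ G) {X : D} {A : C}
    (f : F.obj X ⟶ F.obj (G.obj A)) (hf : f ≫ adj.counit.app A = 0) : f = 0 := by
  have key : ∀ p q : X ⟶ G.obj A,
      F.map p ≫ adj.counit.app A = F.map q ≫ adj.counit.app A → p = q := fun p q h =>
    (adj.homEquiv X A).symm.injective (by simpa [Adjunction.homEquiv_counit] using h)
  obtain ⟨p, rfl⟩ := F.map_surjective f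
  obtain ⟨q, hq⟩ := F.map_surjective (0 : F.obj X ⟶ F.obj (G.obj A))
  rw [← hq]
  exact congrArg F.map (key p q (by rw [hf, hq, zero_comp]))

/-- The cone of the counit of `F ⊣ G` is right orthogonal to the image of `F`, when `F` is full
with image closed under the negative shift. -/
theorem eq_zero_of_counit_distTriang {C : Type*} [Category C] [HasZeroObject C]
    [Preadditive C] [HasShift C ℤ] [∀ n : ℤ, (shiftFunctor C n).Additive] [Pretriangulated C]
    {D : Type*} [Category D] {F : D ⥤ C} {G : C ⥤ D} [F.Full] (adj : F ⊣ G)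
    (hshift : ∀ X : D, ∃ Y : D, Nonempty ((F.obj X)⟦(-1 : ℤ)⟧ ≅ F.obj Y))
    {A B : C} {g : A ⟶ B} {h : B ⟶ (F.obj (G.obj A))⟦(1 : ℤ)⟧}
    (hT : Triangle.mk (adj.counit.app A) g h ∈ distTriang C)
    {X : D} (f : F.obj X ⟶ B) : f = 0 := by
  have hfh : f ≫ h = 0 := by
    obtain ⟨Y, ⟨e⟩⟩ := hshift X
    let w : (F.obj Y)⟦(1 : ℤ)⟧ ≅ F.obj X :=
      (shiftFunctor C (1 : ℤ)).mapIso e.symm ≪≫ shiftNegShift (F.obj X) (1 : ℤ)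
    obtain ⟨v, hv⟩ := (shiftFunctor C (1 : ℤ)).map_surjective (w.hom ≫ f ≫ h)
    have hc : h ≫ (adj.counit.app A)⟦(1 : ℤ)⟧' = 0 := comp_distTriang_mor_zero₃₁ _ hT
    have hv0 : v = 0 := by
      refine eq_zero_of_comp_counit_eq_zero adj v ((shiftFunctor C (1 : ℤ)).map_injective ?_)
      rw [Functor.map_comp, hv, Functor.map_zero, assoc, assoc, hc, comp_zero, comp_zero]
    rw [← cancel_epi w.hom, ← hv, hv0, Functor.map_zero, comp_zero]
  obtain ⟨f', hff'⟩ : ∃ f' : F.obj X ⟶ A, f = f' ≫ g := Triangle.coyoneda_exact₃ _ hT f hfh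
  have hf' : f' = F.map (adj.homEquiv X A f') ≫ adj.counit.app A := by
    simp [Adjunction.homEquiv_unit]
  have hg : adj.counit.app A ≫ g = 0 := comp_distTriang_mor_zero₁₂ _ hT
  rw [hff', hf', assoc, hg, comp_zero]

/-- Let `C` be a pretriangulated category and let `D₀, …, D_m` be full subcategories
(realized as fully faithful functors `ι k : D k ⥤ C`), each closed under isomorphisms and
shifts, each admitting a right adjoint `R k`, and semi-orthogonal: for `i < j` every
morphism from an object of `D j` to an object of `D i` is zero.  Then every object `A` of
`C` fits into a finite tower `A = A₀, A₁, …, A_{m+1}` of distinguished triangles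
`ι_{m-k}(R_{m-k}(A_k)) ⟶ A_k ⟶ A_{k+1} ⟶ (ι_{m-k}(R_{m-k}(A_k)))⟦1⟧` (first morphism the
counit), such that the last object `A_{m+1}` is right orthogonal to every `D i`:
every morphism `ι_i(X) ⟶ A_{m+1}` is zero. -/
theorem tower_of_counit_triangles
    {C : Type*} [Category C] [HasZeroObject C] [Preadditive C] [HasShift C ℤ]
    [∀ n : ℤ, (shiftFunctor C n).Additive] [Pretriangulated C]
    {m : ℕ} {D : Fin (m + 1) → Type*} [∀ k, Category (D k)]
    (ι : ∀ k, D k ⥤ C) [∀ k, (ι k).Full] [∀ k, (ι k).Faithful]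
    (R : ∀ k, C ⥤ D k) (adj : ∀ k, ι k ⊣ R k)
    (hiso : ∀ (k : Fin (m + 1)) (X : D k) (A : C),
      Nonempty ((ι k).obj X ≅ A) → ∃ Y : D k, Nonempty ((ι k).obj Y ≅ A))
    (hshift : ∀ (k : Fin (m + 1)) (X : D k) (n : ℤ),
      ∃ Y : D k, Nonempty (((ι k).obj X)⟦n⟧ ≅ (ι k).obj Y))
    (horth : ∀ i j : Fin (m + 1), i < j →
      ∀ (X : D j) (Y : D i) (f : (ι j).obj X ⟶ (ι i).obj Y), f = 0)
    (A : C) :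
    ∃ As : Fin (m + 2) → C, As 0 = A ∧
      (∀ k : Fin (m + 1),
        ∃ (g : As k.castSucc ⟶ As k.succ)
          (h : As k.succ ⟶ ((ι k.rev).obj ((R k.rev).obj (As k.castSucc)))⟦(1 : ℤ)⟧),
          Triangle.mk ((adj k.rev).counit.app (As k.castSucc)) g h ∈ distTriang C) ∧
      (∀ (i : Fin (m + 1)) (X : D i) (f : (ι i).obj X ⟶ As (Fin.last (m + 1))), f = 0) := by
  obtain ⟨As, h0, hAs⟩ := exists_fin_chain
    (fun (k : Fin (m + 1)) (A B : C) =>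
      ∃ (g : A ⟶ B) (h : B ⟶ ((ι k.rev).obj ((R k.rev).obj A))⟦(1 : ℤ)⟧),
        Triangle.mk ((adj k.rev).counit.app A) g h ∈ distTriang C)
    (fun k A => distinguished_cocone_triangle ((adj k.rev).counit.app A)) A
  refine ⟨As, h0, hAs, ?_⟩
  have key : ∀ (k : Fin (m + 2)) (i : Fin (m + 1)), m + 1 ≤ i.val + k.val →
      ∀ (X : D i) (f : (ι i).obj X ⟶ As k), f = 0 := by
    intro k
    induction k using Fin.induction with
    | zero => intro i hi; have := i.isLt; simp at hi; omega
    | succ k ih =>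
      intro i hi X f
      obtain ⟨g, h, hT⟩ := hAs k
      by_cases hik : i = k.rev
      · subst hik
        exact eq_zero_of_counit_distTriang (adj k.rev) (fun X => hshift k.rev X (-1)) hT f
      · have hlt : k.rev < i := by
          have hne : i.val ≠ k.rev.val := fun h => hik (Fin.ext h)
          rw [Fin.lt_def]
          simp only [Fin.val_rev, Fin.val_succ] at *
          omega
        have hfh : f ≫ h = 0 := by
          obtain ⟨Y, ⟨e⟩⟩ := hshift k.rev ((R k.rev).obj (As k.castSucc)) 1
          rw [← cancel_mono e.hom, zero_comp]
          exact horth _ _ hlt _ _ _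
        obtain ⟨f', hff'⟩ : ∃ f' : (ι i).obj X ⟶ As k.castSucc, f = f' ≫ g :=
          Triangle.coyoneda_exact₃ _ hT f hfh
        have hf' : f' = 0 := by
          refine ih i ?_ X f'
          simp only [Fin.lt_def, Fin.val_rev, Fin.val_castSucc] at *
          omega
        rw [hff', hf', zero_comp]
  intro i X f
  exact key (Fin.last (m + 1)) i (by simp) X f
end
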